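/- Let X be a standard Gaussian random variable and let Y = H₃(X) = X³ − 3X. Define the operator S₃ f(y) = y f(y) − 6 f'(y) − 99y f''(y) + (216 − 27y²) f^{(3)}(y) + 486y f^{(4)}(y) + (486y² − 1944) f^{(5)}(y). Let W be a real-valued random variable with E[W²] < ∞. Then W is equal in law to H₃(X) if and only if E[S₃ f(W)] = 0 for all f ∈ F_{S₃,Y}. -/

import Mathlib

open MeasureTheory ProbabilityTheory Filter Set
open scoped Topology

/-- The standard Gaussian distribution, with density `(2π)^(-1/2) exp(-x²/2)` on `ℝ`. -/
noncomputable def stdGaussian : Measure ℝ :=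
  volume.withDensity fun x =>
    ENNReal.ofReal ((Real.sqrt (2 * Real.pi))⁻¹ * Real.exp (-x ^ 2 / 2))

/-- The law of `H₃(X) = X³ - 3X` for `X` standard Gaussian. -/
noncomputable def lawH3 : Measure ℝ := Measure.map (fun x : ℝ => x ^ 3 - 3 * x) stdGaussian

/-- The Stein operator `S₃ f(y) = y f(y) - 6 f'(y) - 99y f''(y) + (216 - 27y²) f⁽³⁾(y)
+ 486y f⁽⁴⁾(y) + (486y² - 1944) f⁽⁵⁾(y)` for `H₃(X)`. -/
noncomputable def steinH3 (f : ℝ → ℝ) (y : ℝ) : ℝ :=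
  y * f y - 6 * deriv f y - 99 * y * iteratedDeriv 2 f y
    + (216 - 27 * y ^ 2) * iteratedDeriv 3 f y + 486 * y * iteratedDeriv 4 f y
    + (486 * y ^ 2 - 1944) * iteratedDeriv 5 f y

/-- Membership in the class `F_{S₃,Y}` (here `T = 5`, `m = 2`, `I = ℝ`). -/
def memFH3 (f : ℝ → ℝ) : Prop :=
  ContDiff ℝ 5 f ∧
    ∀ t ≤ 5, ∀ j ≤ 2, Integrable (fun y => y ^ j * iteratedDeriv t f y) lawH3

lemma stdG_eq : _root_.stdGaussian = gaussianReal 0 1 := by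
  rw [gaussianReal_of_var_ne_zero _ one_ne_zero]
  unfold _root_.stdGaussian
  congr 1
  ext x
  simp [gaussianPDF, gaussianPDFReal]

instance : IsProbabilityMeasure _root_.stdGaussian := by rw [stdG_eq]; infer_instance

lemma H3_meas : Measurable (fun x : ℝ => x ^ 3 - 3 * x) := by fun_prop

instance : IsProbabilityMeasure lawH3 :=
  Measure.isProbabilityMeasure_map H3_meas.aemeasurable

noncomputable def gd (x : ℝ) : ℝ := (Real.sqrt (2 * Real.pi))⁻¹ * Real.exp (-x ^ 2 / 2)

lemma gd_nonneg (x : ℝ) : 0 ≤ gd x := by unfold gd; positivity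

lemma gd_cont : Continuous gd := by unfold gd; fun_prop

lemma gd_deriv (x : ℝ) : HasDerivAt gd (-x * gd x) x := by
  unfold gd
  have h : HasDerivAt (fun x : ℝ => -x ^ 2 / 2) (-x) x := by
    exact (((hasDerivAt_pow 2 x).neg).div_const 2).congr_deriv (by norm_num; ring)
  exact ((h.exp).const_mul (Real.sqrt (2 * Real.pi))⁻¹).congr_deriv (by ring)

lemma integrable_lawH3 {g : ℝ → ℝ} (hg : Continuous g) :
    Integrable g lawH3 ↔ Integrable (fun x => gd x * g (x ^ 3 - 3 * x)) volume := by
  unfold lawH3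
  rw [integrable_map_measure hg.aestronglyMeasurable H3_meas.aemeasurable]
  unfold _root_.stdGaussian
  rw [integrable_withDensity_iff_integrable_smul' (by fun_prop) (Eventually.of_forall fun x => ENNReal.ofReal_lt_top)]
  apply iff_of_eq
  congr 1
  ext x
  have := gd_nonneg x
  unfold gd at this
  simp only [smul_eq_mul, ENNReal.toReal_ofReal this, gd, Function.comp]

lemma integral_lawH3 {g : ℝ → ℝ} (hg : Continuous g) :
    ∫ y, g y ∂lawH3 = ∫ x, gd x * g (x ^ 3 - 3 * x) := by
  unfold lawH3
  rw [integral_map H3_meas.aemeasurable hg.aestronglyMeasurable]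
  unfold _root_.stdGaussian
  rw [integral_withDensity_eq_integral_toReal_smul (by fun_prop) (Eventually.of_forall fun x => ENNReal.ofReal_lt_top)]
  congr 1
  ext x
  have := gd_nonneg x
  unfold gd at this
  simp only [smul_eq_mul, ENNReal.toReal_ofReal this, gd]

lemma x4_bound (x : ℝ) : x ^ 4 ≤ 100 * (1 + (x ^ 3 - 3 * x) ^ 2) := by
  nlinarith [sq_nonneg (x ^ 3 - 3 * x), sq_nonneg (x^2), sq_nonneg x, mul_nonneg (sq_nonneg x) (sq_nonneg (x^2-4)), sq_nonneg (x^2-2), sq_nonneg (x^2-4)]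

lemma G_int {h : ℝ → ℝ} (hc : Continuous h) (h0 : Integrable h lawH3)
    (h2 : Integrable (fun y => y ^ 2 * h y) lawH3) {q : ℝ → ℝ} (hq : Continuous q) {C : ℝ}
    (hC : ∀ x, |q x| ≤ C * (1 + x ^ 4)) :
    Integrable (fun x => q x * h (x ^ 3 - 3 * x) * gd x) volume := by
  have hC0 : 0 ≤ C := by have := hC 0; simp at this; exact (abs_nonneg _).trans this
  have h0' := ((integrable_lawH3 hc).1 h0).norm
  have h2' := ((integrable_lawH3 (by fun_prop)).1 h2).norm
  have hgc := gd_cont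
  refine ((h0'.const_mul (101 * C)).add (h2'.const_mul (100 * C))).mono'
    (Continuous.aestronglyMeasurable (by fun_prop)) (Eventually.of_forall fun x => ?_)
  simp only [Pi.add_apply, Real.norm_eq_abs, abs_mul, abs_of_nonneg (gd_nonneg x), abs_pow, sq_abs]
  have h1 := (hC x).trans (mul_le_mul_of_nonneg_left
    (show 1 + x ^ 4 ≤ 101 + 100 * (x ^ 3 - 3 * x) ^ 2 by linarith [x4_bound x]) hC0)
  have h3 : 0 ≤ |h (x ^ 3 - 3 * x)| * gd x := mul_nonneg (abs_nonneg _) (gd_nonneg x)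
  have := mul_le_mul_of_nonneg_right h1 h3
  nlinarith [this]

lemma absle {a x C : ℝ} (h : a ^ 2 ≤ (C * (1 + x ^ 4)) ^ 2) (hC : 0 ≤ C) :
    |a| ≤ C * (1 + x ^ 4) := abs_le_of_sq_le_sq h (by positivity)

lemma forward (f : ℝ → ℝ) (hf : memFH3 f) : ∫ y, steinH3 f y ∂lawH3 = 0 := by
  obtain ⟨hcd, hint⟩ := hf
  have hc : ∀ t : ℕ, t ≤ 5 → Continuous (iteratedDeriv t f) := fun t ht =>
    hcd.continuous_iteratedDeriv t (by exact_mod_cast ht)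
  have hd : ∀ t : ℕ, t < 5 → ∀ y, HasDerivAt (iteratedDeriv t f) (iteratedDeriv (t + 1) f y) y := by
    intro t ht y
    rw [iteratedDeriv_succ]
    exact (hcd.differentiable_iteratedDeriv t (by exact_mod_cast ht) y).hasDerivAt
  have c0 := hc 0 (by norm_num)
  have c1 := hc 1 (by norm_num)
  have c2 := hc 2 (by norm_num)
  have c3 := hc 3 (by norm_num)
  have c4 := hc 4 (by norm_num)
  have c5 := hc 5 (by norm_num)
  have hS : steinH3 f = fun y => y * iteratedDeriv 0 f y - 6 * iteratedDeriv 1 f y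
    - 99 * y * iteratedDeriv 2 f y
    + (216 - 27 * y ^ 2) * iteratedDeriv 3 f y + 486 * y * iteratedDeriv 4 f y
    + (486 * y ^ 2 - 1944) * iteratedDeriv 5 f y := by
    ext y; simp [steinH3, iteratedDeriv_one]
  have hSc : Continuous (steinH3 f) := by rw [hS]; fun_prop
  have hSi : Integrable (steinH3 f) lawH3 := by
    rw [hS]
    have e := (((((hint 0 (by norm_num) 1 (by norm_num)).sub
      ((hint 1 (by norm_num) 0 (by norm_num)).const_mul 6)).sub
      ((hint 2 (by norm_num) 1 (by norm_num)).const_mul 99)).add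
      (((hint 3 (by norm_num) 0 (by norm_num)).const_mul 216).sub
      ((hint 3 (by norm_num) 2 (by norm_num)).const_mul 27))).add
      ((hint 4 (by norm_num) 1 (by norm_num)).const_mul 486)).add
      (((hint 5 (by norm_num) 2 (by norm_num)).const_mul 486).sub
      ((hint 5 (by norm_num) 0 (by norm_num)).const_mul 1944))
    refine e.congr (Eventually.of_forall fun y => ?_)
    simp only [Pi.add_apply, Pi.sub_apply]
    ring
  rw [integral_lawH3 hSc]
  have hGi : ∀ t : ℕ, t ≤ 5 → ∀ q : ℝ → ℝ, Continuous q → ∀ C : ℝ, 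
      (∀ x, |q x| ≤ C * (1 + x ^ 4)) → 
      Integrable (fun x => q x * iteratedDeriv t f (x ^ 3 - 3 * x) * gd x) volume := by
    intro t ht q hq C hC
    refine G_int (hc t ht) ?_ (hint t ht 2 le_rfl) hq hC
    simpa using hint t ht 0 (by norm_num)
  have p0 := hGi 0 (by norm_num) (fun x => -(x ^ 2 - 1)) (by fun_prop) 2 (fun x => by
    rw [abs_le]; constructor <;> nlinarith [sq_nonneg (x^2-1), sq_nonneg (x^2), sq_nonneg x])
  have p1 := hGi 1 (by norm_num) (fun x => -3 * x * (x ^ 2 + 1)) (by fun_prop) 100 (fun x => by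
    rw [abs_le]; constructor <;> nlinarith [sq_nonneg (x^2-x), sq_nonneg (x^2+x), sq_nonneg (x^2), sq_nonneg x, sq_nonneg (x+1), sq_nonneg (x-1), sq_nonneg (x^2-1)])
  have p2 := hGi 2 (by norm_num) (fun x => -9 * (x ^ 4 - 7 * x ^ 2 + 18)) (by fun_prop) 1000 (fun x => by
    rw [abs_le]; constructor <;> nlinarith [sq_nonneg (x^2-1), sq_nonneg (x^2), sq_nonneg x])
  have p3 := hGi 3 (by norm_num) (fun x => 54 * x * (x ^ 2 - 5)) (by fun_prop) 2000 (fun x => by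
    rw [abs_le]; constructor <;> nlinarith [sq_nonneg (x^2-x), sq_nonneg (x^2+x), sq_nonneg (x^2), sq_nonneg x, sq_nonneg (x+1), sq_nonneg (x-1), sq_nonneg (x^2-1)])
  have p4 := hGi 4 (by norm_num) (fun x => 162 * (x ^ 4 - 5 * x ^ 2 + 4)) (by fun_prop) 2000 (fun x => by
    rw [abs_le]; constructor <;> nlinarith [sq_nonneg (x^2-1), sq_nonneg (x^2), sq_nonneg x])
  refine integral_eq_zero_of_hasDerivAt_of_integrable (fun x => ?_)
    ((integrable_lawH3 hSc).1 hSi) ((((p0.add p1).add p2).add p3).add p4)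
  have hH : HasDerivAt (fun x : ℝ => x ^ 3 - 3 * x) (3 * x ^ 2 - 3) x := by
    exact ((hasDerivAt_pow 3 x).sub ((hasDerivAt_id' x).const_mul 3)).congr_deriv (by norm_num)
  have hF : ∀ t : ℕ, t < 5 → HasDerivAt (fun x : ℝ => iteratedDeriv t f (x ^ 3 - 3 * x))
      (iteratedDeriv (t + 1) f (x ^ 3 - 3 * x) * (3 * x ^ 2 - 3)) x := fun t ht =>
    (hd t ht _).comp x hH
  have P : ∀ n : ℕ, HasDerivAt (fun x : ℝ => x ^ n) (n * x ^ (n - 1)) x := fun n => hasDerivAt_pow n x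
  have I := hasDerivAt_id' x
  have k0 := ((((P 2).sub_const 1).neg).mul (hF 0 (by norm_num))).mul (gd_deriv x)
  have k1 := (((I.const_mul (-3)).mul ((P 2).add_const 1)).mul (hF 1 (by norm_num))).mul (gd_deriv x)
  have k2 := (((((P 4).sub ((P 2).const_mul 7)).add_const 18).const_mul (-9)).mul (hF 2 (by norm_num))).mul (gd_deriv x)
  have k3 := (((I.const_mul 54).mul ((P 2).sub_const 5)).mul (hF 3 (by norm_num))).mul (gd_deriv x)
  have k4 := (((((P 4).sub ((P 2).const_mul 5)).add_const 4).const_mul 162).mul (hF 4 (by norm_num))).mul (gd_deriv x)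
  refine ((((k0.add k1).add k2).add k3).add k4).congr_deriv ?_
  rw [hS]
  simp only [Pi.add_apply, Pi.sub_apply, Pi.mul_apply, Pi.neg_apply]
  norm_num
  ring

/-! ### Trigonometric test functions -/

lemma sin_iter (a θ : ℝ) :
    iteratedDeriv 0 (fun y => Real.sin (a * y + θ)) = (fun y => Real.sin (a * y + θ)) ∧
    iteratedDeriv 1 (fun y => Real.sin (a * y + θ)) = (fun y => a * Real.cos (a * y + θ)) ∧
    iteratedDeriv 2 (fun y => Real.sin (a * y + θ)) = (fun y => -a ^ 2 * Real.sin (a * y + θ)) ∧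
    iteratedDeriv 3 (fun y => Real.sin (a * y + θ)) = (fun y => -a ^ 3 * Real.cos (a * y + θ)) ∧
    iteratedDeriv 4 (fun y => Real.sin (a * y + θ)) = (fun y => a ^ 4 * Real.sin (a * y + θ)) ∧
    iteratedDeriv 5 (fun y => Real.sin (a * y + θ)) = (fun y => a ^ 5 * Real.cos (a * y + θ)) := by
  have l : ∀ y, HasDerivAt (fun y : ℝ => a * y + θ) a y := fun y => by
    simpa using ((hasDerivAt_id y).const_mul a).add_const θ
  have s : ∀ c : ℝ, deriv (fun y => c * Real.sin (a * y + θ)) = fun y => c * a * Real.cos (a * y + θ) := by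
    intro c; ext y
    rw [((l y).sin.const_mul c).deriv]; ring
  have k : ∀ c : ℝ, deriv (fun y => c * Real.cos (a * y + θ)) = fun y => -(c * a) * Real.sin (a * y + θ) := by
    intro c; ext y
    rw [((l y).cos.const_mul c).deriv]; ring
  have e0 : iteratedDeriv 0 (fun y => Real.sin (a * y + θ)) = (fun y => Real.sin (a * y + θ)) := by simp
  have e1 : iteratedDeriv 1 (fun y => Real.sin (a * y + θ)) = (fun y => a * Real.cos (a * y + θ)) := by
    rw [iteratedDeriv_one]; simpa using s 1
  have e2 : iteratedDeriv 2 (fun y => Real.sin (a * y + θ)) = (fun y => -a ^ 2 * Real.sin (a * y + θ)) := by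
    rw [iteratedDeriv_succ, e1, k]; ext y; ring
  have e3 : iteratedDeriv 3 (fun y => Real.sin (a * y + θ)) = (fun y => -a ^ 3 * Real.cos (a * y + θ)) := by
    rw [iteratedDeriv_succ, e2, s]; ext y; ring
  have e4 : iteratedDeriv 4 (fun y => Real.sin (a * y + θ)) = (fun y => a ^ 4 * Real.sin (a * y + θ)) := by
    rw [iteratedDeriv_succ, e3, k]; ext y; ring
  have e5 : iteratedDeriv 5 (fun y => Real.sin (a * y + θ)) = (fun y => a ^ 5 * Real.cos (a * y + θ)) := by
    rw [iteratedDeriv_succ, e4, s]; ext y; ring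
  exact ⟨e0, e1, e2, e3, e4, e5⟩

lemma stein_sin (a θ y : ℝ) : steinH3 (fun y => Real.sin (a * y + θ)) y =
    (1 + 99 * a ^ 2 + 486 * a ^ 4) * (y * Real.sin (a * y + θ))
    - (6 * a + 216 * a ^ 3 + 1944 * a ^ 5) * Real.cos (a * y + θ)
    + (27 * a ^ 3 + 486 * a ^ 5) * (y ^ 2 * Real.cos (a * y + θ)) := by
  obtain ⟨_, e1, e2, e3, e4, e5⟩ := sin_iter a θ
  unfold steinH3
  rw [← iteratedDeriv_one, e1, e2, e3, e4, e5]
  ring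

lemma sq_int_law : Integrable (fun y : ℝ => y ^ 2) lawH3 := by
  unfold lawH3
  rw [integrable_map_measure (by fun_prop) H3_meas.aemeasurable, stdG_eq]
  have h : ∀ n : ℕ, Integrable (fun x : ℝ => x ^ n) (gaussianReal 0 1) := by
    intro n
    have := (memLp_id_gaussianReal (μ := 0) (v := 1) n).integrable_norm_pow'
    refine this.mono' (by fun_prop) (Eventually.of_forall fun x => ?_)
    simp
  refine (((h 6).sub ((h 4).const_mul 6)).add ((h 2).const_mul 9)).congr
    (Eventually.of_forall fun x => ?_)
  simp only [Pi.add_apply, Pi.sub_apply, Function.comp]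
  ring

lemma one_int {μ : Measure ℝ} [IsProbabilityMeasure μ] (h : Integrable (fun y : ℝ => y ^ 2) μ) :
    Integrable (fun y : ℝ => y) μ := by
  refine ((integrable_const (1 : ℝ)).add h).mono' (by fun_prop) (Eventually.of_forall fun x => ?_)
  simp only [Pi.add_apply, Real.norm_eq_abs]
  rw [abs_le]; constructor <;> nlinarith [sq_nonneg (x - 1), sq_nonneg (x + 1)]

lemma mul_trig_int {μ : Measure ℝ} [IsProbabilityMeasure μ] {g h : ℝ → ℝ} (hg : Integrable g μ)
    (hh : Continuous h) (hb : ∀ x, |h x| ≤ 1) : Integrable (fun y => g y * h y) μ := by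
  have := hg.bdd_mul (f := h) (c := 1) hh.aestronglyMeasurable (Eventually.of_forall hb)
  exact this.congr (Eventually.of_forall fun x => mul_comm _ _)

lemma mem_sin (a θ : ℝ) : memFH3 (fun y => Real.sin (a * y + θ)) := by
  refine ⟨by fun_prop, ?_⟩
  have hp : ∀ j ≤ 2, Integrable (fun y : ℝ => y ^ j) lawH3 := by
    intro j hj
    interval_cases j
    · simp
    · simpa using one_int sq_int_law
    · exact sq_int_law
  obtain ⟨e0, e1, e2, e3, e4, e5⟩ := sin_iter a θ
  have A : ∀ c : ℝ, ∀ j ≤ 2, Integrable (fun y => y ^ j * (c * Real.sin (a * y + θ))) lawH3 := by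
    intro c j hj
    refine ((mul_trig_int (hp j hj) (h := fun y => Real.sin (a * y + θ)) (by fun_prop)
      (fun x => Real.abs_sin_le_one _)).const_mul c).congr (Eventually.of_forall fun x => ?_)
    simp only; ring
  have B : ∀ c : ℝ, ∀ j ≤ 2, Integrable (fun y => y ^ j * (c * Real.cos (a * y + θ))) lawH3 := by
    intro c j hj
    refine ((mul_trig_int (hp j hj) (h := fun y => Real.cos (a * y + θ)) (by fun_prop)
      (fun x => Real.abs_cos_le_one _)).const_mul c).congr (Eventually.of_forall fun x => ?_)
    simp only; ring
  intro t ht j hj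
  interval_cases t
  · rw [e0]; simpa using A 1 j hj
  · rw [e1]; exact B _ j hj
  · rw [e2]; exact A _ j hj
  · rw [e3]; exact B _ j hj
  · rw [e4]; exact A _ j hj
  · rw [e5]; exact B _ j hj

noncomputable def g0 (μ : Measure ℝ) (θ a : ℝ) : ℝ := ∫ y, Real.cos (a * y + θ) ∂μ
noncomputable def g1 (μ : Measure ℝ) (θ a : ℝ) : ℝ := ∫ y, -(y * Real.sin (a * y + θ)) ∂μ
noncomputable def g2 (μ : Measure ℝ) (θ a : ℝ) : ℝ := ∫ y, -(y ^ 2 * Real.cos (a * y + θ)) ∂μ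

lemma lin_deriv (y θ a : ℝ) : HasDerivAt (fun a : ℝ => a * y + θ) y a := by
  simpa using ((hasDerivAt_id a).mul_const y).add_const θ

section
variable {μ : Measure ℝ} [IsProbabilityMeasure μ]

lemma i0 (θ a : ℝ) : Integrable (fun y => Real.cos (a * y + θ)) μ := by
  simpa using mul_trig_int (integrable_const (1:ℝ)) (h := fun y => Real.cos (a * y + θ)) (by fun_prop)
      (fun x => Real.abs_cos_le_one _) (μ := μ)

lemma i1 (h2 : Integrable (fun y : ℝ => y ^ 2) μ) (θ a : ℝ) :
    Integrable (fun y => y * Real.sin (a * y + θ)) μ :=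
  mul_trig_int (one_int h2) (h := fun y => Real.sin (a * y + θ)) (by fun_prop)
      (fun x => Real.abs_sin_le_one _)

lemma i2 (h2 : Integrable (fun y : ℝ => y ^ 2) μ) (θ a : ℝ) :
    Integrable (fun y => y ^ 2 * Real.cos (a * y + θ)) μ :=
  mul_trig_int h2 (h := fun y => Real.cos (a * y + θ)) (by fun_prop)
      (fun x => Real.abs_cos_le_one _)

lemma g0_deriv (h2 : Integrable (fun y : ℝ => y ^ 2) μ) (θ a : ℝ) :
    HasDerivAt (g0 μ θ) (g1 μ θ a) a := by
  refine (hasDerivAt_integral_of_dominated_loc_of_deriv_le (μ := μ) (s := univ)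
    (F := fun a y => Real.cos (a * y + θ)) (F' := fun a y => -(y * Real.sin (a * y + θ)))
    (bound := fun y => ‖y‖) univ_mem
    (Eventually.of_forall fun a => Continuous.aestronglyMeasurable (by fun_prop)) (i0 θ a)
    (Continuous.aestronglyMeasurable (by fun_prop)) (Eventually.of_forall fun y b _ => ?_)
    (one_int h2).norm (Eventually.of_forall fun y b _ => ?_)).2
  · rw [norm_neg, norm_mul]
    exact mul_le_of_le_one_right (norm_nonneg _) (Real.abs_sin_le_one _)
  · exact (lin_deriv y θ b).cos.congr_deriv (by ring)

lemma g1_deriv (h2 : Integrable (fun y : ℝ => y ^ 2) μ) (θ a : ℝ) :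
    HasDerivAt (g1 μ θ) (g2 μ θ a) a := by
  refine (hasDerivAt_integral_of_dominated_loc_of_deriv_le (μ := μ) (s := univ)
    (F := fun a y => -(y * Real.sin (a * y + θ))) (F' := fun a y => -(y ^ 2 * Real.cos (a * y + θ)))
    (bound := fun y => ‖y ^ 2‖) univ_mem
    (Eventually.of_forall fun a => Continuous.aestronglyMeasurable (by fun_prop)) (i1 h2 θ a).neg
    (Continuous.aestronglyMeasurable (by fun_prop)) (Eventually.of_forall fun y b _ => ?_)
    h2.norm (Eventually.of_forall fun y b _ => ?_)).2
  · rw [norm_neg, norm_mul]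
    exact mul_le_of_le_one_right (norm_nonneg _) (Real.abs_cos_le_one _)
  · exact (((lin_deriv y θ b).sin.const_mul y).neg).congr_deriv (by ring)

lemma g_ode (h2 : Integrable (fun y : ℝ => y ^ 2) μ)
    (hS : ∀ f, memFH3 f → ∫ y, steinH3 f y ∂μ = 0) (θ a : ℝ) :
    (27 * a ^ 3 + 486 * a ^ 5) * g2 μ θ a + (1 + 99 * a ^ 2 + 486 * a ^ 4) * g1 μ θ a
      + (6 * a + 216 * a ^ 3 + 1944 * a ^ 5) * g0 μ θ a = 0 := by
  have := hS _ (mem_sin a θ)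
  simp only [stein_sin] at this
  have hsub : Integrable (fun y => (1 + 99 * a ^ 2 + 486 * a ^ 4) * (y * Real.sin (a * y + θ))
      - (6 * a + 216 * a ^ 3 + 1944 * a ^ 5) * Real.cos (a * y + θ)) μ :=
    ((i1 h2 θ a).const_mul _).sub ((i0 θ a).const_mul _)
  rw [integral_add hsub ((i2 h2 θ a).const_mul _),
    integral_sub ((i1 h2 θ a).const_mul _) ((i0 θ a).const_mul _),
    integral_const_mul, integral_const_mul, integral_const_mul] at this
  unfold g0 g1 g2
  rw [integral_neg, integral_neg]
  linarith

end

lemma ode_unique (u u1 u2 : ℝ → ℝ) (hu : ∀ a, HasDerivAt u (u1 a) a)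
    (hu1 : ∀ a, HasDerivAt u1 (u2 a) a)
    (ho : ∀ a, (27 * a ^ 3 + 486 * a ^ 5) * u2 a + (1 + 99 * a ^ 2 + 486 * a ^ 4) * u1 a
      + (6 * a + 216 * a ^ 3 + 1944 * a ^ 5) * u a = 0)
    (h0 : u 0 = 0) {a : ℝ} (ha : 0 < a) : u a = 0 := by
  have h10 : u1 0 = 0 := by simpa using ho 0
  set E : ℝ → ℝ := fun a => u1 a ^ 2 + 4 * u a ^ 2 + 2 / 9 * (a⁻¹ * u a) ^ 2 with hE
  have hEd : ∀ x, 0 < x → HasDerivAt E (2 * u1 x * u2 x + 8 * u x * u1 x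
      + 4 / 9 * (x⁻¹ * u x) * (-(x ^ 2)⁻¹ * u x + x⁻¹ * u1 x)) x := by
    intro x hx
    have := (((hu1 x).pow 2).add (((hu x).pow 2).const_mul 4)).add
      ((((hasDerivAt_inv hx.ne').mul (hu x)).pow 2).const_mul (2 / 9))
    refine this.congr_deriv ?_
    simp only [Pi.mul_apply]
    norm_num
    ring
  have hanti : AntitoneOn E (Ioi 0) := by
    refine antitoneOn_of_deriv_nonpos (convex_Ioi 0)
      (fun x hx => (hEd x hx).continuousAt.continuousWithinAt)
      (fun x hx => ?_) (fun x hx => ?_)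
    · rw [interior_Ioi] at hx
      exact (hEd x hx).differentiableAt.differentiableWithinAt
    · rw [interior_Ioi] at hx
      have hx : 0 < x := hx
      rw [(hEd x hx).deriv]
      have ho' := ho x
      have hA : 0 < 27 * x ^ 3 + 486 * x ^ 5 := by positivity
      have h2 : u2 x = -((1 + 99 * x ^ 2 + 486 * x ^ 4) * u1 x
        + (6 * x + 216 * x ^ 3 + 1944 * x ^ 5) * u x) / (27 * x ^ 3 + 486 * x ^ 5) := by
        rw [eq_div_iff hA.ne']; linarith
      have key : 2 * u1 x * u2 x + 8 * u x * u1 x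
        + 4 / 9 * (x⁻¹ * u x) * (-(x ^ 2)⁻¹ * u x + x⁻¹ * u1 x)
        = -(2 * (1 + 99 * x ^ 2 + 486 * x ^ 4) / (27 * x ^ 3 + 486 * x ^ 5) * u1 x ^ 2
          + 4 / 9 * (x⁻¹) ^ 3 * u x ^ 2) := by
        have hB : (1 + 18 * x ^ 2) ≠ 0 := by positivity
        have hAB : 27 * x ^ 3 + 486 * x ^ 5 = 27 * x ^ 3 * (1 + 18 * x ^ 2) := by ring
        rw [h2, hAB]
        field_simp
        ring
      rw [key]
      have : 0 ≤ 2 * (1 + 99 * x ^ 2 + 486 * x ^ 4) / (27 * x ^ 3 + 486 * x ^ 5) * u1 x ^ 2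
          + 4 / 9 * (x⁻¹) ^ 3 * u x ^ 2 := by positivity
      linarith
  have hlim : Tendsto E (𝓝[>] 0) (𝓝 0) := by
    have t1 : Tendsto u1 (𝓝[>] 0) (𝓝 0) := by
      have := (hu1 0).continuousAt.tendsto; rw [h10] at this
      exact this.mono_left nhdsWithin_le_nhds
    have t0 : Tendsto u (𝓝[>] 0) (𝓝 0) := by
      have := (hu 0).continuousAt.tendsto; rw [h0] at this
      exact this.mono_left nhdsWithin_le_nhds
    have ts : Tendsto (fun x => x⁻¹ * u x) (𝓝[>] 0) (𝓝 0) := by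
      have := (hasDerivAt_iff_tendsto_slope_zero.1 (hu 0))
      simp only [zero_add, h0, sub_zero, h10, smul_eq_mul] at this
      exact this.mono_left (nhdsWithin_mono _ (fun x hx => ne_of_gt hx))
    simpa using ((t1.pow 2).add ((t0.pow 2).const_mul 4)).add ((ts.pow 2).const_mul (2 / 9))
  have hle : E a ≤ 0 := by
    refine ge_of_tendsto hlim ?_
    filter_upwards [Ioo_mem_nhdsGT ha] with x hx
    exact hanti hx.1 ha hx.2.le
  have : u a ^ 2 ≤ 0 := by
    simp only [hE] at hle
    nlinarith [sq_nonneg (u1 a), sq_nonneg (a⁻¹ * u a), sq_nonneg (u a)]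
  exact pow_eq_zero_iff (two_ne_zero) |>.1 (le_antisymm this (sq_nonneg _))

lemma g_eq {μ μ' : Measure ℝ} [IsProbabilityMeasure μ] [IsProbabilityMeasure μ']
    (h2 : Integrable (fun y : ℝ => y ^ 2) μ) (h2' : Integrable (fun y : ℝ => y ^ 2) μ')
    (hS : ∀ f, memFH3 f → ∫ y, steinH3 f y ∂μ = 0)
    (hS' : ∀ f, memFH3 f → ∫ y, steinH3 f y ∂μ' = 0) (θ a : ℝ) : g0 μ θ a = g0 μ' θ a := by
  have z : ∀ θ, g0 μ θ 0 = g0 μ' θ 0 := by intro θ; simp [g0]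
  have pos : ∀ θ a, 0 < a → g0 μ θ a = g0 μ' θ a := by
    intro θ a ha
    have := ode_unique (fun a => g0 μ θ a - g0 μ' θ a) (fun a => g1 μ θ a - g1 μ' θ a)
      (fun a => g2 μ θ a - g2 μ' θ a) (fun a => (g0_deriv h2 θ a).sub (g0_deriv h2' θ a))
      (fun a => (g1_deriv h2 θ a).sub (g1_deriv h2' θ a))
      (fun a => by linear_combination g_ode h2 hS θ a - g_ode h2' hS' θ a)
      (by simp [z θ]) ha
    exact sub_eq_zero.1 this
  have sym : ∀ μ : Measure ℝ, g0 μ θ a = g0 μ (-θ) (-a) := by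
    intro μ
    unfold g0
    congr 1; ext y
    rw [← Real.cos_neg]; congr 1; ring
  rcases lt_trichotomy a 0 with h | h | h
  · rw [sym μ, sym μ']; exact pos _ _ (by linarith)
  · rw [h]; exact z θ
  · exact pos _ _ h

lemma charFun_g {μ : Measure ℝ} [IsProbabilityMeasure μ] (t : ℝ) :
    charFun μ t = (g0 μ 0 t : ℂ) + (g0 μ (-(Real.pi / 2)) t : ℂ) * Complex.I := by
  rw [charFun_apply_real]
  unfold g0
  rw [← integral_complex_ofReal, ← integral_complex_ofReal, ← integral_mul_const, ← integral_add]
  · congr 1; ext y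
    rw [← sub_eq_add_neg, Real.cos_sub_pi_div_two, add_zero]
    push_cast
    rw [Complex.exp_mul_I]
  · exact (i0 0 t).ofReal
  · exact (i0 _ t).ofReal.mul_const _

lemma backward {μ : Measure ℝ} [IsProbabilityMeasure μ]
    (h2 : Integrable (fun y : ℝ => y ^ 2) μ)
    (hS : ∀ f, memFH3 f → ∫ y, steinH3 f y ∂μ = 0) : μ = lawH3 := by
  refine Measure.ext_of_charFun (funext fun t => ?_)
  rw [charFun_g, charFun_g, g_eq h2 sq_int_law hS forward, g_eq h2 sq_int_law hS forward]

lemma stein_cont {f : ℝ → ℝ} (hf : memFH3 f) : Continuous (steinH3 f) := by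
  have hc : ∀ t : ℕ, t ≤ 5 → Continuous (iteratedDeriv t f) := fun t ht =>
    hf.1.continuous_iteratedDeriv t (by exact_mod_cast ht)
  have c0 : Continuous f := hf.1.continuous
  have c1 := hc 1 (by norm_num)
  rw [iteratedDeriv_one] at c1
  have c2 := hc 2 (by norm_num)
  have c3 := hc 3 (by norm_num)
  have c4 := hc 4 (by norm_num)
  have c5 := hc 5 (by norm_num)
  unfold steinH3
  fun_prop

/-- Stein characterisation of `H₃(X) = X³ - 3X`, `X ∼ N(0,1)`, via the
operator `S₃` with coefficients of minimal polynomial degree. -/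
theorem stein_characterisation_H3
    {Ω : Type*} [MeasurableSpace Ω] (ν : Measure Ω) [IsProbabilityMeasure ν]
    (W : Ω → ℝ) (hW : Measurable W)
    (hWmom : Integrable (fun ω => (W ω) ^ 2) ν) :
    Measure.map W ν = lawH3 ↔
      ∀ f : ℝ → ℝ, memFH3 f → ∫ ω, steinH3 f (W ω) ∂ν = 0 := by
  have hm : ∀ f, memFH3 f → ∫ ω, steinH3 f (W ω) ∂ν = ∫ y, steinH3 f y ∂(Measure.map W ν) :=
    fun f hf => (integral_map hW.aemeasurable (stein_cont hf).aestronglyMeasurable).symm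
  have : IsProbabilityMeasure (Measure.map W ν) := Measure.isProbabilityMeasure_map hW.aemeasurable
  constructor
  · intro h f hf
    rw [hm f hf, h]
    exact forward f hf
  · intro h
    refine backward ?_ (fun f hf => by rw [← hm f hf]; exact h f hf)
    rw [integrable_map_measure (by fun_prop) hW.aemeasurable]
    exact hWmom
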